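/- arXiv:2406.11351 — 4 statements merged into one kernel-verified Lean document; each statement's English description precedes it below -/
import Mathlib

section
/- The variable updating mapping F_{σ,w} is continuous; in fact it preserves arbitrary nonempty unions: for every nonempty subset S ⊆ Env_w (not necessarily directed), F_{σ,w}(⋃S) = ⋃_{u∈S} F_{σ,w}(u). -/
namespace MuCal

/-- Basic formulas Φ_k over atomic propositions `At` and `k` registers. -/
inductive Phi (At : Type) (k : ℕ) : Type
  | tt : Phi At k
  | ff : Phi At k
  | pos : At → Phi At k
  | npos : At → Phi At k
  | up : Fin k → Phi At k
  | nup : Fin k → Phi At k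
  | conj : Phi At k → Phi At k → Phi At k

/-- LTL↓dω formulas over variables `Var`. -/
inductive Fml (At : Type) (k : ℕ) (Var : Type) : Type
  | var : Var → Fml At k Var
  | or : Fml At k Var → Fml At k Var → Fml At k Var
  | dX : Finset (Fin k) → Fml At k Var → Phi At k → Fml At k Var
  | tt : Fml At k Var

variable {At D Q Var : Type} {k : ℕ}

/-- θ[R←d] : update the registers in `R` to hold `d`. -/
def updA (θ : Fin k → D) (R : Finset (Fin k)) (d : D) : Fin k → D :=
  fun r => if r ∈ R then d else θ r

/-- Satisfaction of basic formulas: w,i,θ ⊨ φ. -/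
def phiSat (w : ℕ → Set At × D) (i : ℕ) (θ : Fin k → D) : Phi At k → Prop
  | Phi.tt => True
  | Phi.ff => False
  | Phi.pos p => p ∈ (w i).1
  | Phi.npos p => p ∉ (w i).1
  | Phi.up r => θ r = (w i).2
  | Phi.nup r => θ r ≠ (w i).2
  | Phi.conj φ₁ φ₂ => phiSat w i θ φ₁ ∧ phiSat w i θ φ₂

/-- Environments: each variable gets a set of 5-tuples (i,θ;j,θ′,x). -/
abbrev Env (D : Type) (k : ℕ) (Var : Type) : Type :=
  Var → Set (ℕ × (Fin k → D) × ℕ × (Fin k → D) × Var)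

/-- The augmented relation w,i,θ,j,θ′,x ⊨_u ψ. -/
def aSat (vtt : Var) (w : ℕ → Set At × D) (u : Env D k Var) :
    Fml At k Var → ℕ → (Fin k → D) → ℕ → (Fin k → D) → Var → Prop
  | Fml.var V, i, θ, j, θ', x => (i, θ, j, θ', x) ∈ u V
  | Fml.or ψ₁ ψ₂, i, θ, j, θ', x =>
      aSat vtt w u ψ₁ i θ j θ' x ∨ aSat vtt w u ψ₂ i θ j θ' x
  | Fml.dX R ψ φ, i, θ, j, θ', x =>
      i < j ∧ phiSat w i θ φ ∧ aSat vtt w u ψ (i + 1) (updA θ R (w i).2) j θ' x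
  | Fml.tt, _, θ, _, θ', x => θ = θ' ∧ x = vtt

/-- A system of equations: σ with a main variable, ω-variables, and V_tt. -/
structure EqSys (At : Type) (k : ℕ) (Var : Type) where
  σ : Var → Fml At k Var
  main : Var
  omega : Set Var
  vtt : Var

/-- Well-formedness conditions from Definition (system of equations):
V_tt ∈ Var_ω, σ(V_tt) = tt, and σ is injective on ω-variables. -/
def EqSys.WF (S : EqSys At k Var) : Prop :=
  S.vtt ∈ S.omega ∧ S.σ S.vtt = Fml.tt ∧
    ∀ V ∈ S.omega, ∀ V' : Var, S.σ V = S.σ V' → V = V'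

/-- The variable updating mapping F_{σ,w}. -/
def Fmap (S : EqSys At k Var) (w : ℕ → Set At × D) (u : Env D k Var) : Env D k Var :=
  fun V =>
    {t | aSat S.vtt w u (S.σ V) t.1 t.2.1 t.2.2.1 t.2.2.2.1 t.2.2.2.2} ∪
    {t | V ∈ S.omega ∧ ∃ (i : ℕ) (θ : Fin k → D), t = (i, θ, i, θ, V)}

/-- The least fixed point of F_{σ,w} (Knaster–Tarski form). -/
def lfpEnv (S : EqSys At k Var) (w : ℕ → Set At × D) : Env D k Var :=
  sInf {u | Fmap S w u ≤ u}

/-- w,i,θ ⊨_u V : an infinite chain of dependence through u exists. -/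
def satVar (S : EqSys At k Var) (w : ℕ → Set At × D) (u : Env D k Var)
    (i : ℕ) (θ : Fin k → D) (V : Var) : Prop :=
  ∃ (I : ℕ → ℕ) (Θ : ℕ → Fin k → D) (X : ℕ → Var),
    I 0 = i ∧ Θ 0 = θ ∧ X 0 = V ∧
    (∀ n, I n < I (n + 1)) ∧ (∀ n, X (n + 1) ∈ S.omega) ∧
    (∀ n, (I n, Θ n, I (n + 1), Θ (n + 1), X (n + 1)) ∈ u (X n))

/-- w ⊨ σ : w,1,⊥^k ⊨_{lfp(F_{σ,w})} V_main. -/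
def sats (S : EqSys At k Var) (dbot : D) (w : ℕ → Set At × D) : Prop :=
  satVar S w (lfpEnv S w) 1 (fun _ => dbot) S.main

/-- Normal form: every equation is V = V′ ∨ V″, V = ↓_R X V′ ∧ φ, or V = tt. -/
def InNormalForm (S : EqSys At k Var) : Prop :=
  ∀ V : Var,
    (∃ V₁ V₂ : Var, S.σ V = Fml.or (Fml.var V₁) (Fml.var V₂)) ∨
    (∃ (R : Finset (Fin k)) (V₁ : Var) (φ : Phi At k), S.σ V = Fml.dX R (Fml.var V₁) φ) ∨
    S.σ V = Fml.tt

/-- `IsDisj ψ s` : ψ is an iterated disjunction of exactly the variables in `s`. -/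
inductive IsDisj {At : Type} {k : ℕ} {Var : Type} : Fml At k Var → Set Var → Prop
  | var (V : Var) : IsDisj (Fml.var V) {V}
  | or {ψ₁ ψ₂ : Fml At k Var} {s₁ s₂ : Set Var} :
      IsDisj ψ₁ s₁ → IsDisj ψ₂ s₂ → IsDisj (Fml.or ψ₁ ψ₂) (s₁ ∪ s₂)

/-- A Büchi register automaton with k registers; `none` as guard means ε. -/
structure BRA (At : Type) (k : ℕ) (Q : Type) where
  q0 : Q
  δ : Set (Q × Option (Phi At k) × Finset (Fin k) × Q)
  acc : Set Q

/-- One transition step on IDs (q,θ,i), where i is the current position. -/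
inductive BStep (A : BRA At k Q) (w : ℕ → Set At × D) :
    Q × (Fin k → D) × ℕ → Q × (Fin k → D) × ℕ → Prop
  | rule {q q' : Q} {φ : Phi At k} {R : Finset (Fin k)} {θ : Fin k → D} {i : ℕ} :
      (q, some φ, R, q') ∈ A.δ → phiSat w i θ φ →
      BStep A w (q, θ, i) (q', updA θ R (w i).2, i + 1)
  | eps {q q' : Q} {θ : Fin k → D} {i : ℕ} :
      (q, none, (∅ : Finset (Fin k)), q') ∈ A.δ →
      BStep A w (q, θ, i) (q', θ, i)

/-- ⊢* : reflexive-transitive closure of the step relation. -/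
def BSteps (A : BRA At k Q) (w : ℕ → Set At × D) :
    Q × (Fin k → D) × ℕ → Q × (Fin k → D) × ℕ → Prop :=
  Relation.ReflTransGen (BStep A w)

/-- Büchi acceptance: some accepting state is visited at infinitely many,
strictly increasing positions, starting from (q₀, ⊥^k) at position 1. -/
def accepts (A : BRA At k Q) (dbot : D) (w : ℕ → Set At × D) : Prop :=
  ∃ qF ∈ A.acc, ∃ (I : ℕ → ℕ) (Θ : ℕ → Fin k → D),
    1 ≤ I 0 ∧ (∀ n, I n < I (n + 1)) ∧
    BSteps A w (A.q0, fun _ => dbot, 1) (qF, Θ 0, I 0) ∧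
    ∀ n, BSteps A w (qF, Θ n, I n) (qF, Θ (n + 1), I (n + 1))

def lang (A : BRA At k Q) (dbot : D) : Set (ℕ → Set At × D) :=
  {w | accepts A dbot w}

/-- The BRA constructed from a normal-form system σ (Theorem μ↓dω → BRA):
states are the formulas σ(V), initial state σ(V_t), accepting states σ(V_ω). -/
def toBRA (S : EqSys At k Var) : BRA At k (Fml At k Var) where
  q0 := S.σ S.main
  δ :=
    {t | t = (Fml.tt, some Phi.tt, (∅ : Finset (Fin k)), Fml.tt)} ∪
    {t | ∃ V V₁ V₂ : Var, S.σ V = Fml.or (Fml.var V₁) (Fml.var V₂) ∧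
          (t = (S.σ V, none, (∅ : Finset (Fin k)), S.σ V₁) ∨
           t = (S.σ V, none, (∅ : Finset (Fin k)), S.σ V₂))} ∪
    {t | ∃ (V : Var) (R : Finset (Fin k)) (V₁ : Var) (φ : Phi At k),
          S.σ V = Fml.dX R (Fml.var V₁) φ ∧ t = (S.σ V, some φ, R, S.σ V₁)}
  acc := S.σ '' S.omega

/-- Variables of the system constructed from a BRA:
V_q for q ∈ Q, V_r for r ∈ δ, and V_tt. -/
abbrev RVar (A : BRA At k Q) : Type := Q ⊕ ({r // r ∈ A.δ} ⊕ Unit)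

/-- The BRA 𝒜′ obtained by applying the μ↓dω-to-BRA construction (with m-ary
disjunction states) to the system σ constructed from 𝒜. -/
def roundBRA (A : BRA At k Q) (S : EqSys At k (RVar A)) :
    BRA At k (Fml At k (RVar A)) where
  q0 := S.σ (Sum.inl A.q0)
  δ :=
    {t | t = (Fml.tt, some Phi.tt, (∅ : Finset (Fin k)), Fml.tt)} ∪
    {t | ∃ (q : Q) (r : {r // r ∈ A.δ}), r.val.1 = q ∧
          t = (S.σ (Sum.inl q), none, (∅ : Finset (Fin k)), S.σ (Sum.inr (Sum.inl r)))} ∪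
    {t | ∃ r : {r // r ∈ A.δ},
          t = (S.σ (Sum.inr (Sum.inl r)), r.val.2.1, r.val.2.2.1,
               S.σ (Sum.inl r.val.2.2.2))}
  acc := (fun q : Q => S.σ (Sum.inl q)) '' A.acc ∪ {Fml.tt}

end MuCal

namespace MuCal

theorem aSat_iUnion_iff {At D Var : Type} {k : ℕ} {vtt : Var} {w : ℕ → Set At × D}
    {𝒮 : Set (Env D k Var)} (h𝒮 : 𝒮.Nonempty) (ψ : Fml At k Var)
    (i : ℕ) (θ : Fin k → D) (j : ℕ) (θ' : Fin k → D) (x : Var) :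
    aSat vtt w (fun V => ⋃ u ∈ 𝒮, u V) ψ i θ j θ' x ↔
      ∃ u ∈ 𝒮, aSat vtt w u ψ i θ j θ' x := by
  induction ψ generalizing i θ with
  | var V => simp [aSat]
  | or ψ₁ ψ₂ ih₁ ih₂ =>
    simp only [aSat, ih₁, ih₂]
    grind
  | dX R ψ φ ih =>
    simp only [aSat, ih]
    grind
  | tt =>
    obtain ⟨u, hu⟩ := h𝒮
    exact ⟨fun h => ⟨u, hu, h⟩, fun ⟨_, _, h⟩ => h⟩

end MuCal

open MuCal
/-- F_{σ,w} is continuous: it preserves arbitrary nonempty unions. -/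
theorem Fmap_continuous (At D : Type) [Finite At] [Countable D] [Infinite D]
    (k : ℕ) (Var : Type) [Finite Var]
    (S : EqSys At k Var) (hWF : S.WF) (w : ℕ → Set At × D)
    (𝒮 : Set (Env D k Var)) (h𝒮 : 𝒮.Nonempty) :
    Fmap S w (fun V => ⋃ u ∈ 𝒮, u V) = fun V => ⋃ u ∈ 𝒮, Fmap S w u V := by
  ext V t
  simp only [Fmap, Set.mem_union, Set.mem_ofPred_eq, Set.mem_iUnion, exists_prop,
    aSat_iUnion_iff h𝒮]
  obtain ⟨u, hu⟩ := h𝒮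
  grind
end

section
/- (Theorem: μ↓dω-calculus to Büchi RA) Let σ be a system of equations over Var with main variable V_t, in normal form (every equation of the form V = V′ ∨ V″, V = ↓_R X V′ ∧ φ, or V = tt). Define the k-BRA 𝒜 = (Q, σ(V_t), δ, F) with Q = {σ(V) | V ∈ Var}; δ containing (tt, tt, ∅) → tt, the rules (V_i ∨ V_j, ε, ∅) → σ(V_i) and (V_i ∨ V_j, ε, ∅) → σ(V_j) for every state V_i ∨ V_j ∈ Q, and the rule (↓_R X V_i ∧ φ, φ, R) → σ(V_i) for every state ↓_R X V_i ∧ φ ∈ Q; and F = {σ(V_ω) | V_ω ∈ Var_ω}. Then 𝒜 is equivalent to σ: L(𝒜) = {w | w ⊨ σ}. -/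
namespace MuCal

variable {At D Var : Type} {k : ℕ}

theorem aSat_mono {vtt : Var} {w : ℕ → Set At × D} {u v : Env D k Var} (huv : u ≤ v)
    {ψ : Fml At k Var} {i : ℕ} {θ : Fin k → D} {j : ℕ} {θ' : Fin k → D} {x : Var}
    (h : aSat vtt w u ψ i θ j θ' x) : aSat vtt w v ψ i θ j θ' x := by
  induction ψ generalizing i θ with
  | var V => exact huv V h
  | or ψ₁ ψ₂ ih₁ ih₂ => exact h.imp ih₁ ih₂
  | dX R ψ φ ih => exact ⟨h.1, h.2.1, ih h.2.2⟩
  | tt => exact h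

theorem Fmap_mono (S : EqSys At k Var) (w : ℕ → Set At × D) : Monotone (Fmap S w) :=
  fun _ _ huv _ _ ht => ht.imp (aSat_mono huv) id

theorem lfpEnv_le {S : EqSys At k Var} {w : ℕ → Set At × D} {u : Env D k Var}
    (hu : Fmap S w u ≤ u) : lfpEnv S w ≤ u :=
  sInf_le hu

theorem Fmap_lfpEnv_le (S : EqSys At k Var) (w : ℕ → Set At × D) :
    Fmap S w (lfpEnv S w) ≤ lfpEnv S w :=
  le_sInf fun _ hu => (Fmap_mono S w (lfpEnv_le hu)).trans hu

theorem mem_lfpEnv_of_aSat {S : EqSys At k Var} {w : ℕ → Set At × D} {V x : Var}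
    {i j : ℕ} {θ θ' : Fin k → D} (h : aSat S.vtt w (lfpEnv S w) (S.σ V) i θ j θ' x) :
    (i, θ, j, θ', x) ∈ lfpEnv S w V :=
  Fmap_lfpEnv_le S w V (Or.inl h)

theorem mem_lfpEnv_diag {S : EqSys At k Var} {w : ℕ → Set At × D} {V : Var}
    (hV : V ∈ S.omega) (i : ℕ) (θ : Fin k → D) : (i, θ, i, θ, V) ∈ lfpEnv S w V :=
  Fmap_lfpEnv_le S w V (Or.inr ⟨hV, i, θ, rfl⟩)

theorem BStep.le {Q : Type} {A : BRA At k Q} {w : ℕ → Set At × D}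
    {a b : Q × (Fin k → D) × ℕ} (h : BStep A w a b) : a.2.2 ≤ b.2.2 := by
  cases h
  · exact Nat.le_succ _
  · exact le_rfl

theorem BSteps.le {Q : Type} {A : BRA At k Q} {w : ℕ → Set At × D}
    {a b : Q × (Fin k → D) × ℕ} (h : BSteps A w a b) : a.2.2 ≤ b.2.2 := by
  induction h with
  | refl => exact le_rfl
  | tail _ h ih => exact ih.trans h.le

theorem updA_empty (θ : Fin k → D) (d : D) : updA θ ∅ d = θ := by
  funext r
  simp [updA]

theorem toBRA_bStep_tt (S : EqSys At k Var) (w : ℕ → Set At × D) (θ : Fin k → D) (i : ℕ) :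
    BStep (toBRA S) w (Fml.tt, θ, i) (Fml.tt, θ, i + 1) := by
  have h : BStep (toBRA S) w (Fml.tt, θ, i) (Fml.tt, updA θ ∅ (w i).2, i + 1) :=
    .rule (φ := Phi.tt) (Or.inl (Or.inl rfl)) trivial
  rwa [updA_empty] at h

theorem toBRA_bSteps_tt (S : EqSys At k Var) (w : ℕ → Set At × D) (θ : Fin k → D) {i j : ℕ}
    (hij : i ≤ j) : BSteps (toBRA S) w (Fml.tt, θ, i) (Fml.tt, θ, j) := by
  induction j, hij using Nat.le_induction with
  | base => exact .refl
  | succ j _ ih => exact ih.tail (toBRA_bStep_tt S w θ j)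

theorem bSteps_of_mem_lfpEnv {S : EqSys At k Var} (hWF : S.WF) (hNF : InNormalForm S)
    {w : ℕ → Set At × D} {V x : Var} {i j : ℕ} {θ θ' : Fin k → D}
    (h : (i, θ, j, θ', x) ∈ lfpEnv S w V) (hij : i ≤ j) :
    BSteps (toBRA S) w (S.σ V, θ, i) (S.σ x, θ', j) := by
  let u : Env D k Var := fun V => {t | t.1 ≤ t.2.2.1 →
    BSteps (toBRA S) w (S.σ V, t.2.1, t.1) (S.σ t.2.2.2.2, t.2.2.2.1, t.2.2.1)}
  suffices hu : Fmap S w u ≤ u from lfpEnv_le hu V h hij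
  rintro V ⟨i, θ, j, θ', x⟩ (hs | ⟨_, i', θ₀, heq⟩) hij
  · dsimp only at hs hij ⊢
    rcases hNF V with ⟨V₁, V₂, hV⟩ | ⟨R, V₁, φ, hV⟩ | hV
    · rw [hV] at hs
      rcases hs with hs | hs
      · exact .head (.eps (Or.inl (Or.inr ⟨V, V₁, V₂, hV, Or.inl rfl⟩))) (hs hij)
      · exact .head (.eps (Or.inl (Or.inr ⟨V, V₁, V₂, hV, Or.inr rfl⟩))) (hs hij)
    · rw [hV] at hs
      exact .head (.rule (Or.inr ⟨V, R, V₁, φ, hV, rfl⟩) hs.2.1) (hs.2.2 (Nat.succ_le_of_lt hs.1))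
    · rw [hV] at hs
      obtain ⟨hθ, hx⟩ : θ = θ' ∧ x = S.vtt := hs
      subst hθ hx
      rw [hV, hWF.2.1]
      exact toBRA_bSteps_tt S w θ hij
  · cases heq
    exact .refl

/-- The three kinds of transition out of a state `σ V`, read off from the shape of `σ V`. -/
theorem toBRA_bStep_cases {S : EqSys At k Var} {w : ℕ → Set At × D}
    {V : Var} {i : ℕ} {θ : Fin k → D} {c : Fml At k Var × (Fin k → D) × ℕ}
    (h : BStep (toBRA S) w (S.σ V, θ, i) c) :
    (S.σ V = Fml.tt ∧ c = (Fml.tt, θ, i + 1)) ∨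
    (∃ V₁ V₂ : Var, S.σ V = Fml.or (Fml.var V₁) (Fml.var V₂) ∧
      (c = (S.σ V₁, θ, i) ∨ c = (S.σ V₂, θ, i))) ∨
    ∃ (R : Finset (Fin k)) (V₁ : Var) (φ : Phi At k), S.σ V = Fml.dX R (Fml.var V₁) φ ∧
      phiSat w i θ φ ∧ c = (S.σ V₁, updA θ R (w i).2, i + 1) := by
  cases h with
  | rule hδ hφ =>
    rcases hδ with (hδ | ⟨V', V₁, V₂, hV', hδ | hδ⟩) | ⟨V', R, V₁, φ, hV', hδ⟩
    · simp only [Set.mem_ofPred_eq, Prod.mk.injEq] at hδ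
      obtain ⟨hV, -, rfl, rfl⟩ := hδ
      exact Or.inl ⟨hV, by rw [updA_empty]⟩
    · simp at hδ
    · simp at hδ
    · simp only [Prod.mk.injEq, Option.some.injEq] at hδ
      obtain ⟨hV, rfl, rfl, rfl⟩ := hδ
      exact Or.inr (Or.inr ⟨_, V₁, _, hV.trans hV', hφ, rfl⟩)
  | eps hδ =>
    rcases hδ with (hδ | ⟨V', V₁, V₂, hV', hδ | hδ⟩) | ⟨V', R, V₁, φ, hV', hδ⟩
    · simp at hδ
    · simp only [Prod.mk.injEq, true_and] at hδ
      exact Or.inr (Or.inl ⟨V₁, V₂, hδ.1.trans hV', Or.inl (by rw [hδ.2])⟩)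
    · simp only [Prod.mk.injEq, true_and] at hδ
      exact Or.inr (Or.inl ⟨V₁, V₂, hδ.1.trans hV', Or.inr (by rw [hδ.2])⟩)
    · simp at hδ

theorem mem_lfpEnv_of_bSteps {S : EqSys At k Var} (hWF : S.WF)
    {w : ℕ → Set At × D} {V x : Var} (hx : x ∈ S.omega) {i j : ℕ} {θ θ' : Fin k → D}
    (h : BSteps (toBRA S) w (S.σ V, θ, i) (S.σ x, θ', j)) :
    (i, θ, j, θ', x) ∈ lfpEnv S w V := by
  suffices key : ∀ a, BSteps (toBRA S) w a (S.σ x, θ', j) → ∀ V i θ, a = (S.σ V, θ, i) →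
      (i, θ, j, θ', x) ∈ lfpEnv S w V ∧ (S.σ V = Fml.tt → x = S.vtt ∧ θ = θ') from
    (key _ h V i θ rfl).1
  intro a ha
  induction ha using Relation.ReflTransGen.head_induction_on with
  | refl =>
    intro V i θ heq
    simp only [Prod.mk.injEq] at heq
    obtain ⟨hxV, rfl, rfl⟩ := heq
    obtain rfl := hWF.2.2 x hx V hxV
    exact ⟨mem_lfpEnv_diag hx _ _,
      fun hV => ⟨hWF.2.2 x hx S.vtt (hV.trans hWF.2.1.symm), rfl⟩⟩
  | head hstep hrest ih =>
    rintro V i θ rfl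
    rcases toBRA_bStep_cases hstep with
      ⟨hV, rfl⟩ | ⟨V₁, V₂, hV, rfl | rfl⟩ | ⟨R, V₁, φ, hV, hφ, rfl⟩
    · obtain ⟨rfl, rfl⟩ := (ih S.vtt (i + 1) θ (by rw [hWF.2.1])).2 hWF.2.1
      refine ⟨mem_lfpEnv_of_aSat ?_, fun _ => ⟨rfl, rfl⟩⟩
      rw [hV]
      exact ⟨rfl, rfl⟩
    · refine ⟨mem_lfpEnv_of_aSat ?_, by simp [hV]⟩
      rw [hV]
      exact Or.inl (ih V₁ i θ rfl).1
    · refine ⟨mem_lfpEnv_of_aSat ?_, by simp [hV]⟩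
      rw [hV]
      exact Or.inr (ih V₂ i θ rfl).1
    · refine ⟨mem_lfpEnv_of_aSat ?_, by simp [hV]⟩
      rw [hV]
      exact ⟨BSteps.le hrest, hφ, (ih V₁ (i + 1) _ rfl).1⟩

theorem sats_of_accepts {S : EqSys At k Var} (hWF : S.WF) {dbot : D} {w : ℕ → Set At × D}
    (h : accepts (toBRA S) dbot w) : sats S dbot w := by
  obtain ⟨_, ⟨x, hx, rfl⟩, I, Θ, hI0, hI, hstart, hloop⟩ := h
  refine ⟨fun | 0 => 1 | n + 1 => I (n + 1), fun | 0 => fun _ => dbot | n + 1 => Θ (n + 1),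
    fun | 0 => S.main | _ + 1 => x, rfl, rfl, rfl, ?_, fun _ => hx, ?_⟩
  · rintro (_ | n)
    · exact hI0.trans_lt (hI 0)
    · exact hI (n + 1)
  · rintro (_ | n)
    · exact mem_lfpEnv_of_bSteps hWF hx (hstart.trans (hloop 0))
    · exact mem_lfpEnv_of_bSteps hWF hx (hloop (n + 1))

theorem accepts_of_sats [Finite Var] {S : EqSys At k Var} (hWF : S.WF) (hNF : InNormalForm S)
    {dbot : D} {w : ℕ → Set At × D} (h : sats S dbot w) : accepts (toBRA S) dbot w := by
  obtain ⟨I, Θ, X, hI0, hΘ0, hX0, hI, hX, hmem⟩ := h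
  have hmono : StrictMono I := strictMono_nat_of_lt_succ hI
  have hsteps : ∀ m n, m ≤ n →
      BSteps (toBRA S) w (S.σ (X m), Θ m, I m) (S.σ (X n), Θ n, I n) := by
    intro m n hmn
    induction n, hmn using Nat.le_induction with
    | base => exact .refl
    | succ n _ ih => exact ih.trans (bSteps_of_mem_lfpEnv hWF hNF (hmem n) (hI n).le)
  obtain ⟨x, hx⟩ := Finite.exists_infinite_fiber fun n => X (n + 1)
  obtain ⟨f, hfmono, hf⟩ : ∃ f : ℕ → ℕ, StrictMono f ∧ ∀ n, X (f n + 1) = x :=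
    Filter.extraction_of_frequently_atTop
      (Nat.frequently_atTop_iff_infinite.2 (Set.infinite_coe_iff.1 hx))
  have hlt : ∀ n, f n + 1 < f (n + 1) + 1 := fun n =>
    Nat.succ_lt_succ (hfmono n.lt_succ_self)
  refine ⟨S.σ x, ⟨x, hf 0 ▸ hX _, rfl⟩, fun n => I (f n + 1), fun n => Θ (f n + 1),
    ?_, fun n => hmono (hlt n), ?_, fun n => ?_⟩
  · exact hI0 ▸ hmono.monotone (Nat.zero_le _)
  · have h := hsteps 0 (f 0 + 1) (Nat.zero_le _)
    rwa [hI0, hΘ0, hX0, hf] at h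
  · have h := hsteps _ _ (hlt n).le
    rwa [hf, hf] at h

end MuCal

open MuCal
/-- Theorem: μ↓dω-calculus to Büchi RA: the BRA constructed from
a normal-form system σ recognizes exactly {w | w ⊨ σ}. -/
theorem toBRA_lang (At D : Type) [Finite At] [Countable D] [Infinite D] (dbot : D)
    (k : ℕ) (Var : Type) [Finite Var]
    (S : EqSys At k Var) (hWF : S.WF) (hNF : InNormalForm S) :
    lang (toBRA S) dbot = {w : ℕ → Set At × D | sats S dbot w} := by
  ext w
  exact ⟨sats_of_accepts hWF, accepts_of_sats hWF hNF⟩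
end

section
/- (Backward direction of the finite-run correspondence, by induction on the number of transitions) Let σ be a system of equations in normal form, 𝒜 the k-BRA constructed from σ, and u^ℓ = F_{σ,w}^ℓ(∅). If (σ(V),θ,w[i..]) ⊢*_𝒜 (σ(x),θ′,w[j..]) with i ≤ j and σ(x) ∈ F (where x ∈ Var_ω), then there exists ℓ ≥ 0 such that w,i,θ,j,θ′,x ⊨_{u^ℓ} V. -/
open MuCal
@[simp]
theorem MuCal.updA_empty_s8 {D : Type} {k : ℕ} (θ : Fin k → D) (d : D) : updA θ ∅ d = θ := by
  funext r
  simp [updA]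

theorem MuCal.BStep.le_s8 {At D Q : Type} {k : ℕ} {A : BRA At k Q} {w : ℕ → Set At × D}
    {c c' : Q × (Fin k → D) × ℕ} (h : BStep A w c c') : c.2.2 ≤ c'.2.2 := by
  cases h <;> simp

theorem MuCal.BSteps.le_s8 {At D Q : Type} {k : ℕ} {A : BRA At k Q} {w : ℕ → Set At × D}
    {c c' : Q × (Fin k → D) × ℕ} (h : BSteps A w c c') : c.2.2 ≤ c'.2.2 := by
  induction h with
  | refl => exact le_rfl
  | tail _ hstep ih => exact ih.trans hstep.le_s8

/-- A step of the constructed automaton from `σ V` reflects back one application of `F_{σ,w}`. -/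
theorem MuCal.mem_iterate_Fmap_of_BStep {At D Var : Type} {k : ℕ} {S : EqSys At k Var}
    (hWF : S.WF) {w : ℕ → Set At × D} {i i₁ j : ℕ} {θ θ₁ θ' : Fin k → D} {V x : Var}
    {q : Fml At k Var} (hx : x ∈ S.omega) (hstep : BStep (toBRA S) w (S.σ V, θ, i) (q, θ₁, i₁))
    (hle : i₁ ≤ j)
    (ih : ∀ V₁, S.σ V₁ = q →
      ∃ ℓ : ℕ, (i₁, θ₁, j, θ', x) ∈ (Fmap S w)^[ℓ] (fun _ => ∅ : Env D k Var) V₁) :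
    ∃ ℓ : ℕ, (i, θ, j, θ', x) ∈ (Fmap S w)^[ℓ] (fun _ => ∅ : Env D k Var) V := by
  cases hstep with
  | rule hδ hφ =>
    rcases hδ with (h | ⟨_, _, _, _, h | h⟩) | ⟨V', R, V₁, φ, hV', h⟩
    · simp only [Set.mem_ofPred_eq, Prod.mk.injEq, Option.some.injEq] at h
      obtain ⟨hV, rfl, rfl, rfl⟩ := h
      obtain ⟨ℓ, hℓ⟩ := ih V hV
      refine ⟨1, Or.inl ?_⟩
      cases ℓ with
      | zero => exact hℓ.elim
      | succ ℓ =>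
        rw [Function.iterate_succ_apply'] at hℓ
        rcases hℓ with hℓ | ⟨-, i₀, θ₀, h⟩
        · simpa [hV, aSat] using hℓ
        · simp only [updA_empty_s8, Prod.mk.injEq] at h
          obtain ⟨-, rfl, -, rfl, rfl⟩ := h
          simpa [hV, aSat] using hWF.2.2 x hx S.vtt (hV.trans hWF.2.1.symm)
    · simp at h
    · simp at h
    · simp only [Prod.mk.injEq, Option.some.injEq] at h
      obtain ⟨hV, rfl, rfl, rfl⟩ := h
      obtain ⟨ℓ, hℓ⟩ := ih V₁ rfl
      refine ⟨ℓ + 1, ?_⟩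
      rw [Function.iterate_succ_apply']
      refine Or.inl ?_
      simpa [hV, hV', aSat] using ⟨hle, hφ, hℓ⟩
  | eps hδ =>
    rcases hδ with (h | ⟨V', V₁, V₂, hV', h⟩) | ⟨_, _, _, _, _, h⟩
    · simp at h
    · obtain ⟨hV, V₀, hV₀, rfl⟩ : S.σ V = S.σ V' ∧ ∃ V₀, (V₀ = V₁ ∨ V₀ = V₂) ∧ q = S.σ V₀ := by
        rcases h with h | h <;> simp only [Prod.mk.injEq, true_and] at h
        · exact ⟨h.1, V₁, Or.inl rfl, h.2⟩
        · exact ⟨h.1, V₂, Or.inr rfl, h.2⟩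
      obtain ⟨ℓ, hℓ⟩ := ih V₀ rfl
      refine ⟨ℓ + 1, ?_⟩
      rw [Function.iterate_succ_apply']
      refine Or.inl ?_
      rcases hV₀ with rfl | rfl
      · simpa [hV, hV', aSat] using Or.inl hℓ
      · simpa [hV, hV', aSat] using Or.inr hℓ
    · simp at h

/-- A run of the constructed automaton from `σ V` to `σ x` with `x` an ω-variable is witnessed at
some finite level of the iteration of `F_{σ,w}` from the empty environment. -/
theorem MuCal.mem_iterate_Fmap_of_BSteps {At D Var : Type} {k : ℕ} {S : EqSys At k Var}
    (hWF : S.WF) {w : ℕ → Set At × D} {j : ℕ} {θ' : Fin k → D} {x : Var} (hx : x ∈ S.omega)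
    {c : Fml At k Var × (Fin k → D) × ℕ} (hrun : BSteps (toBRA S) w c (S.σ x, θ', j))
    {V : Var} (hV : S.σ V = c.1) :
    ∃ ℓ : ℕ, (c.2.2, c.2.1, j, θ', x) ∈ (Fmap S w)^[ℓ] (fun _ => ∅ : Env D k Var) V := by
  induction hrun using Relation.ReflTransGen.head_induction_on generalizing V with
  | refl =>
    obtain rfl := hWF.2.2 x hx V hV.symm
    exact ⟨1, Or.inr ⟨hx, j, θ', rfl⟩⟩
  | @head c c₁ hstep hrest ih =>
    obtain ⟨q, θ, i⟩ := c
    obtain ⟨q₁, θ₁, i₁⟩ := c₁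
    obtain rfl : S.σ V = q := hV
    exact mem_iterate_Fmap_of_BStep hWF hx hstep (BSteps.le_s8 hrest) fun V₁ hV₁ => ih hV₁

/-- Backward direction of the finite-run correspondence: a run
(σ(V),θ,w[i..]) ⊢* (σ(x),θ′,w[j..]) with σ(x) ∈ F yields some level ℓ with
w,i,θ,j,θ′,x ⊨_{F^ℓ(∅)} V. -/
theorem finite_run_backward (At D : Type) [Finite At] [Countable D] [Infinite D]
    (k : ℕ) (Var : Type) [Finite Var]
    (S : EqSys At k Var) (hWF : S.WF) (hNF : InNormalForm S)
    (w : ℕ → Set At × D) (i j : ℕ) (hij : i ≤ j) (θ θ' : Fin k → D)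
    (V : Var) (x : Var) (hx : x ∈ S.omega)
    (hrun : BSteps (toBRA S) w (S.σ V, θ, i) (S.σ x, θ', j))
    (hacc : S.σ x ∈ (toBRA S).acc) :
    ∃ ℓ : ℕ, (i, θ, j, θ', x) ∈ (Fmap S w)^[ℓ] (fun _ => ∅ : Env D k Var) V := by
  exact mem_iterate_Fmap_of_BSteps hWF hx hrun rfl
end

section
/- (Run correspondence between a BRA and its round-trip translation) Let 𝒜 = (Q, q₀, δ, F) be a k-BRA without ε-rules in which every state has at least one outgoing transition, let σ be the system of equations constructed from 𝒜 (with variables V_q for q ∈ Q and V_r for r ∈ δ), and let 𝒜′ = (Q′, σ(V_{q₀}), δ′, F′) be the BRA obtained by applying the μ↓dω-to-BRA construction to σ (with m-ary disjunction states, i.e. with a rule (σ(V_q), ε, ∅) → σ(V_r) for each q ∈ Q and r ∈ δ|_q, a rule (σ(V_r), φ, R) → σ(V_{q′}) for each r = (q,φ,R) → q′ ∈ δ, and the rule (tt, tt, ∅) → tt; F′ = {σ(V_q) | q ∈ F} ∪ {tt}). Then for all infinite data words w, states q, q′ ∈ Q, positions i ≤ j, and assignments θ, θ′: (q,θ,w[i..])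 ⊢*_𝒜 (q′,θ′,w[j..]) if and only if (σ(V_q),θ,w[i..]) ⊢*_{𝒜′} (σ(V_{q′}),θ′,w[j..]). -/
open MuCal
namespace MuCal

variable {At D Q Var : Type} {k : ℕ}

theorem IsDisj.set_unique {ψ : Fml At k Var} {s t : Set Var}
    (hs : IsDisj ψ s) (ht : IsDisj ψ t) : s = t := by
  induction hs generalizing t with
  | var V => cases ht; rfl
  | or _ _ ih₁ ih₂ =>
    cases ht with
    | or h₁ h₂ => rw [ih₁ h₁, ih₂ h₂]

theorem IsDisj.ne_tt {ψ : Fml At k Var} {s : Set Var} (h : IsDisj ψ s) : ψ ≠ Fml.tt := by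
  rintro rfl
  cases h

theorem IsDisj.ne_dX {ψ χ : Fml At k Var} {R : Finset (Fin k)} {φ : Phi At k} {s : Set Var}
    (h : IsDisj ψ s) : ψ ≠ Fml.dX R χ φ := by
  rintro rfl
  cases h

/-- The equations of the states are pairwise distinct when every state has an outgoing rule. -/
theorem state_equation_injective {A : BRA At k Q}
    (hOut : ∀ q : Q, ∃ r ∈ A.δ, r.1 = q) {S : EqSys At k (RVar A)}
    (hq : ∀ q : Q, IsDisj (S.σ (Sum.inl q))
      {V : RVar A | ∃ r : {r // r ∈ A.δ}, r.val.1 = q ∧ V = Sum.inr (Sum.inl r)}) :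
    Function.Injective fun q : Q => S.σ (Sum.inl q) := by
  intro q p (h : S.σ (Sum.inl q) = S.σ (Sum.inl p))
  obtain ⟨r, hr, hrq⟩ := hOut q
  have hsets := (hq q).set_unique (h ▸ hq p)
  have hmem : (Sum.inr (Sum.inl ⟨r, hr⟩) : RVar A) ∈
      {V : RVar A | ∃ r : {r // r ∈ A.δ}, r.val.1 = q ∧ V = Sum.inr (Sum.inl r)} :=
    ⟨⟨r, hr⟩, hrq, rfl⟩
  rw [hsets] at hmem
  obtain ⟨r', hr'p, hr'⟩ := hmem
  obtain rfl : (⟨r, hr⟩ : {r // r ∈ A.δ}) = r' := Sum.inl_injective (Sum.inr_injective hr')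
  exact hrq.symm.trans hr'p

/-- A configuration of the round-trip automaton that a run of `A` from `c` accounts for: either
`A` reaches the corresponding state, or it reaches a state at which the rule is about to fire. -/
def Simulated (A : BRA At k Q) (S : EqSys At k (RVar A)) (w : ℕ → Set At × D)
    (c : Q × (Fin k → D) × ℕ) (x : Fml At k (RVar A) × (Fin k → D) × ℕ) : Prop :=
  (∃ p, x.1 = S.σ (Sum.inl p) ∧ BSteps A w c (p, x.2)) ∨
  ∃ p φ R p', x.1 = Fml.dX R (Fml.var (Sum.inl p')) φ ∧ (p, some φ, R, p') ∈ A.δ ∧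
    BSteps A w c (p, x.2)

theorem Simulated.step {A : BRA At k Q} {S : EqSys At k (RVar A)}
    (hNoEps : ∀ (q : Q) (R : Finset (Fin k)) (q' : Q), (q, none, R, q') ∉ A.δ)
    (hOut : ∀ q : Q, ∃ r ∈ A.δ, r.1 = q)
    (hq : ∀ q : Q, IsDisj (S.σ (Sum.inl q))
      {V : RVar A | ∃ r : {r // r ∈ A.δ}, r.val.1 = q ∧ V = Sum.inr (Sum.inl r)})
    (hr : ∀ (r : {r // r ∈ A.δ}) (q : Q) (φ : Phi At k) (R : Finset (Fin k)) (q' : Q),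
      r.val = (q, some φ, R, q') →
      S.σ (Sum.inr (Sum.inl r)) = Fml.dX R (Fml.var (Sum.inl q')) φ)
    {w : ℕ → Set At × D} {c : Q × (Fin k → D) × ℕ} {x y : Fml At k (RVar A) × (Fin k → D) × ℕ}
    (hx : Simulated A S w c x) (hxy : BStep (roundBRA A S) w x y) : Simulated A S w c y := by
  cases hxy with
  | @rule ψ ψ' φ R θ i hδ hφ =>
    rcases hδ with (h | ⟨_, _, _, h⟩) | ⟨⟨⟨p, o, R', p'⟩, hmem⟩, h⟩
    · simp only [Set.mem_ofPred_eq, Prod.mk.injEq] at h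
      rcases hx with ⟨p, hp, _⟩ | ⟨_, _, _, _, hp, _⟩
      · exact absurd (hp.symm.trans h.1) (hq p).ne_tt
      · simp [h.1] at hp
    · simp at h
    · simp only [Prod.mk.injEq] at h
      obtain ⟨rfl, rfl, rfl, rfl⟩ := h
      have hdX := hr ⟨_, hmem⟩ _ _ _ _ rfl
      rcases hx with ⟨p₁, hp, _⟩ | ⟨p₁, _, _, _, hp, hmem₁, hsteps⟩
      · exact absurd (hp.symm.trans hdX) (hq p₁).ne_dX
      · have heq := hp.symm.trans hdX
        simp only [Fml.dX.injEq, Fml.var.injEq, Sum.inl.injEq] at heq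
        obtain ⟨rfl, rfl, rfl⟩ := heq
        exact Or.inl ⟨_, rfl, hsteps.tail (.rule hmem₁ hφ)⟩
  | @eps ψ ψ' θ i hδ =>
    rcases hδ with (h | ⟨p, ⟨⟨p₁, o, R, p'⟩, hmem⟩, hp₁, h⟩) | ⟨⟨⟨p, o, R', p'⟩, hmem⟩, h⟩
    · simp at h
    · simp only [Prod.mk.injEq, true_and] at h hp₁
      obtain ⟨rfl, rfl⟩ := h
      subst hp₁
      cases o with
      | none => exact absurd hmem (hNoEps _ _ _)
      | some φ =>
        rcases hx with ⟨p₂, hp, hsteps⟩ | ⟨_, _, _, _, hp, _⟩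
        · obtain rfl := state_equation_injective hOut hq hp
          exact Or.inr ⟨_, φ, R, p', hr ⟨_, hmem⟩ _ _ _ _ rfl, hmem, hsteps⟩
        · exact absurd hp (hq _).ne_dX
    · simp only [Prod.mk.injEq] at h
      obtain ⟨-, rfl, -⟩ := h
      exact absurd hmem (hNoEps _ _ _)

theorem Simulated.of_steps {A : BRA At k Q} {S : EqSys At k (RVar A)}
    (hNoEps : ∀ (q : Q) (R : Finset (Fin k)) (q' : Q), (q, none, R, q') ∉ A.δ)
    (hOut : ∀ q : Q, ∃ r ∈ A.δ, r.1 = q)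
    (hq : ∀ q : Q, IsDisj (S.σ (Sum.inl q))
      {V : RVar A | ∃ r : {r // r ∈ A.δ}, r.val.1 = q ∧ V = Sum.inr (Sum.inl r)})
    (hr : ∀ (r : {r // r ∈ A.δ}) (q : Q) (φ : Phi At k) (R : Finset (Fin k)) (q' : Q),
      r.val = (q, some φ, R, q') →
      S.σ (Sum.inr (Sum.inl r)) = Fml.dX R (Fml.var (Sum.inl q')) φ)
    {w : ℕ → Set At × D} {c : Q × (Fin k → D) × ℕ} {x y : Fml At k (RVar A) × (Fin k → D) × ℕ}
    (hx : Simulated A S w c x) (hxy : BSteps (roundBRA A S) w x y) : Simulated A S w c y := by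
  induction hxy with
  | refl => exact hx
  | tail _ hstep ih => exact ih.step hNoEps hOut hq hr hstep

/-- A step of an ε-free automaton is matched by an ε-step followed by a rule step. -/
theorem BStep.roundBRA_steps {A : BRA At k Q} (S : EqSys At k (RVar A))
    (hNoEps : ∀ (q : Q) (R : Finset (Fin k)) (q' : Q), (q, none, R, q') ∉ A.δ)
    {w : ℕ → Set At × D} {x y : Q × (Fin k → D) × ℕ} (hxy : BStep A w x y) :
    BSteps (roundBRA A S) w (S.σ (Sum.inl x.1), x.2) (S.σ (Sum.inl y.1), y.2) := by
  cases hxy with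
  | rule hmem hφ =>
    refine .head (.eps (q' := S.σ (Sum.inr (Sum.inl ⟨_, hmem⟩))) ?_) (.single (.rule ?_ hφ))
    · exact Or.inl (Or.inr ⟨_, ⟨_, hmem⟩, rfl, rfl⟩)
    · exact Or.inr ⟨⟨_, hmem⟩, rfl⟩
  | eps hmem => exact absurd hmem (hNoEps _ _ _)

end MuCal

/-- Run correspondence between a BRA and its round-trip translation:
(q,θ,w[i..]) ⊢*_𝒜 (q′,θ′,w[j..]) iff (σ(V_q),θ,w[i..]) ⊢*_{𝒜′} (σ(V_{q′}),θ′,w[j..]). -/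
theorem round_trip_run_correspondence (At D Q : Type) [Finite At] [Countable D] [Infinite D]
    (k : ℕ) [Finite Q] (A : BRA At k Q)
    (hNoEps : ∀ (q : Q) (R : Finset (Fin k)) (q' : Q), (q, none, R, q') ∉ A.δ)
    (hOut : ∀ q : Q, ∃ (φ : Phi At k) (R : Finset (Fin k)) (q' : Q), (q, some φ, R, q') ∈ A.δ)
    (S : EqSys At k (RVar A))
    (hmain : S.main = Sum.inl A.q0)
    (hvtt : S.vtt = Sum.inr (Sum.inr ()))
    (homega : S.omega = Sum.inl '' A.acc ∪ {Sum.inr (Sum.inr ())})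
    (hq : ∀ q : Q, IsDisj (S.σ (Sum.inl q))
        {V : RVar A | ∃ r : {r // r ∈ A.δ}, r.val.1 = q ∧ V = Sum.inr (Sum.inl r)})
    (hr : ∀ (r : {r // r ∈ A.δ}) (q : Q) (φ : Phi At k) (R : Finset (Fin k)) (q' : Q),
        r.val = (q, some φ, R, q') →
        S.σ (Sum.inr (Sum.inl r)) = Fml.dX R (Fml.var (Sum.inl q')) φ)
    (htt : S.σ (Sum.inr (Sum.inr ())) = Fml.tt)
    (w : ℕ → Set At × D) (q q' : Q) (i j : ℕ) (hij : i ≤ j) (θ θ' : Fin k → D) :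
    BSteps A w (q, θ, i) (q', θ', j) ↔
      BSteps (roundBRA A S) w (S.σ (Sum.inl q), θ, i) (S.σ (Sum.inl q'), θ', j) := by
  have hOut' : ∀ q : Q, ∃ r ∈ A.δ, r.1 = q := fun q =>
    let ⟨_, _, _, hmem⟩ := hOut q
    ⟨_, hmem, rfl⟩
  constructor
  · intro h
    refine Relation.ReflTransGen.lift'
      (fun x : Q × (Fin k → D) × ℕ => (S.σ (Sum.inl x.1), x.2)) ?_ _ _ h
    exact fun _ _ hxy => hxy.roundBRA_steps S hNoEps
  · intro h
    have hsim : Simulated A S w (q, θ, i) (S.σ (Sum.inl q'), θ', j) :=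
      .of_steps (x := (S.σ (Sum.inl q), θ, i)) hNoEps hOut' hq hr
        (Or.inl ⟨q, rfl, .refl⟩) h
    rcases hsim with ⟨p, hp, hsteps⟩ | ⟨_, _, _, _, hp, _⟩
    · obtain rfl := state_equation_injective hOut' hq hp
      exact hsteps
    · exact absurd hp (hq q').ne_dX
end
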